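/- arXiv:1610.03027 — 3 statements merged into one kernel-verified Lean document; each statement's English description precedes it below -/
import Mathlib

section
/- For each constant C₁ > 0, there exists a constant C₂ = C₂(C₁) > 0 such that the following holds. Let n, k₁, k₂, t₀ be positive integers with n/C₁ < k₁ < n/2 − C₂, n/C₁ < k₂ < n/2 − C₂, |k₁ − k₂| ≤ C₁, and t₀ ≥ C₂ / log₂((n−k₁)/k₁). Suppose G₁ ⊆ {S ⊆ {1,...,n} : |S| = k₁} and G₂ ⊆ {S ⊆ {1,...,n} : |S| = k₂} are cross-intersecting families with |G₁| ≤ C(n−t₀, k₁−t₀). Then |G₂| + C₁·|G₁| ≤ C(n, k₂), and equality holds only if G₁ = ∅. -/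
open Finset

/-- Two families are cross-intersecting if every set in the first family meets
every set in the second family. -/
def CrossIntersecting {n : ℕ} (A B : Finset (Finset (Fin n))) : Prop :=
  ∀ S ∈ A, ∀ T ∈ B, (S ∩ T).Nonempty

open scoped FinsetFamily in
/-- Cross-intersecting families obey a Kruskal–Katona type bound: if the first family is at least
as large as the family of `k₁`-sets containing a fixed `(t + 1)`-set, then the second one misses at
least as many `k₂`-sets as there are avoiding that `(t + 1)`-set. -/
lemma CrossIntersecting.card_add_choose_le {n k₁ k₂ t : ℕ} {G₁ G₂ : Finset (Finset (Fin n))}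
    (h : CrossIntersecting G₁ G₂) (h₁ : ∀ S ∈ G₁, S.card = k₁) (h₂ : ∀ S ∈ G₂, S.card = k₂)
    (hk : k₁ + k₂ ≤ n) (ht : t + 1 ≤ k₁)
    (hG : (n - t - 1).choose (k₁ - t - 1) ≤ G₁.card) :
    G₂.card + (n - t - 1).choose k₂ ≤ n.choose k₂ := by
  have hsized : (G₁ᶜˢ : Set (Finset (Fin n))).Sized (n - k₁) := by
    have : (G₁ : Set (Finset (Fin n))).Sized k₁ := fun S hS => h₁ S hS
    simpa using this.compls
  have hG' : (n - t - 1).choose (n - k₁) ≤ G₁ᶜˢ.card := by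
    rwa [card_compls, Nat.choose_symm_of_eq_add (show n - t - 1 = (n - k₁) + (k₁ - t - 1) by omega)]
  have kk := kruskal_katona_lovasz_form (i := n - k₁ - k₂) (by omega) (by omega) (by omega)
    hsized hG'
  rw [show n - k₁ - (n - k₁ - k₂) = k₂ by omega] at kk
  have hdisj : Disjoint G₂ (∂^[n - k₁ - k₂] G₁ᶜˢ) := disjoint_right.2 fun T hT hT₂ => by
    simp only [mem_shadow_iterate_iff_exists_sdiff, mem_compls] at hT
    obtain ⟨U, hU, hTU, -⟩ := hT
    obtain ⟨x, hx⟩ := h _ hU T hT₂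
    rw [mem_inter, mem_compl] at hx
    exact hx.1 (hTU hx.2)
  calc G₂.card + (n - t - 1).choose k₂ ≤ G₂.card + (∂^[n - k₁ - k₂] G₁ᶜˢ).card := by gcongr
    _ = (G₂ ∪ ∂^[n - k₁ - k₂] G₁ᶜˢ).card := (card_union_of_disjoint hdisj).symm
    _ ≤ n.choose k₂ := by
      have hU : ((G₂ ∪ ∂^[n - k₁ - k₂] G₁ᶜˢ : Finset (Finset (Fin n))) :
          Set (Finset (Fin n))).Sized k₂ := by
        rw [coe_union, Set.sized_union]
        refine ⟨fun S hS => h₂ S hS, ?_⟩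
        have := hsized.shadow_iterate (k := n - k₁ - k₂)
        rwa [show n - k₁ - (n - k₁ - k₂) = k₂ by omega] at this
      simpa using hU.card_le

/-- If `(k + j) / (s + j) ≥ 1 + x` in the relevant range, then `C(m, k)` exceeds `C(m, s)` by an
exponential factor, where `m = k + s + 1 + i`. -/
lemma one_add_pow_mul_choose_le {k s : ℕ} {x : ℝ} (hx : 0 ≤ x) (i : ℕ)
    (h : ∀ j : ℕ, j ≤ i + 1 → (1 + x) * (s + j) ≤ k + j) :
    (1 + x) ^ i * (k + 1) * ((k + s + 1 + i).choose s : ℝ) ≤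
      (s + 1) * ((k + s + 1 + i).choose k : ℝ) := by
  induction i with
  | zero =>
    have h₁ := Nat.choose_succ_right_eq (k + s + 1) k
    rw [show k + s + 1 - k = s + 1 by omega,
      Nat.choose_symm_of_eq_add (show k + s + 1 = (k + 1) + s by omega)] at h₁
    have h₂ : ((k + s + 1).choose s : ℝ) * (k + 1) = (k + s + 1).choose k * (s + 1) := by
      exact_mod_cast h₁
    simp only [pow_zero, one_mul, add_zero]
    linarith
  | succ i ih =>
    have ih := ih fun j hj => h j (by omega)
    have hj := h (i + 2) le_rfl
    push_cast at hj
    have hk := Nat.choose_mul_succ_eq (k + s + 1 + i) k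
    have hs := Nat.choose_mul_succ_eq (k + s + 1 + i) s
    rw [show k + s + 1 + i + 1 - k = s + (i + 2) by omega] at hk
    rw [show k + s + 1 + i + 1 - s = k + (i + 2) by omega] at hs
    rw [show k + s + 1 + (i + 1) = k + s + 1 + i + 1 by omega]
    have hkR : ((k + s + 1 + i).choose k : ℝ) * (k + s + 1 + i + 1) =
      (k + s + 1 + i + 1).choose k * (s + (i + 2)) := by exact_mod_cast hk
    have hsR : ((k + s + 1 + i).choose s : ℝ) * (k + s + 1 + i + 1) =
      (k + s + 1 + i + 1).choose s * (k + (i + 2)) := by exact_mod_cast hs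
    set A : ℝ := ((k + s + 1 + i + 1).choose s : ℝ)
    set B : ℝ := ((k + s + 1 + i + 1).choose k : ℝ)
    have hpos : (0 : ℝ) < s + (i + 2) := by positivity
    refine le_of_mul_le_mul_right ?_ hpos
    calc (1 + x) ^ (i + 1) * (k + 1) * A * (s + (i + 2))
        = (1 + x) ^ i * (k + 1) * A * ((1 + x) * (s + (i + 2))) := by ring
      _ ≤ (1 + x) ^ i * (k + 1) * A * (k + (i + 2)) := by gcongr
      _ = (1 + x) ^ i * (k + 1) * ((k + s + 1 + i).choose s : ℝ) * (k + s + 1 + i + 1) := by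
        rw [mul_assoc, ← hsR]; ring
      _ ≤ (s + 1) * ((k + s + 1 + i).choose k : ℝ) * (k + s + 1 + i + 1) := by gcongr
      _ = (s + 1) * B * (s + (i + 2)) := by rw [mul_assoc, hkR]; ring

/-- Linear version of the comparison of `C(m + 1, s + 1)` with `C(m, k)`,
where `m = k + s + 1 + i` and `s ≤ k`. -/
lemma one_add_mul_choose_succ_le {k s : ℕ} (hsk : s ≤ k) (i : ℕ) :
    (1 + i * (((k : ℝ) - s) / (k + i + 1))) * (k + 1) *
        ((k + s + 1 + i + 1).choose (s + 1) : ℝ) ≤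
      (k + s + 1 + i + 1) * ((k + s + 1 + i).choose k : ℝ) := by
  have hskR : (s : ℝ) ≤ k := by exact_mod_cast hsk
  set x : ℝ := ((k : ℝ) - s) / (k + i + 1) with hx_def
  have hx : 0 ≤ x := div_nonneg (by linarith) (by positivity)
  have key := one_add_pow_mul_choose_le (k := k) (s := s) hx i fun j hj => by
    have hjR : (j : ℝ) ≤ i + 1 := by exact_mod_cast hj
    have : x * (s + j) ≤ k - s := by
      rw [hx_def, div_mul_eq_mul_div, div_le_iff₀ (by positivity)]
      exact mul_le_mul_of_nonneg_left (by linarith) (by linarith)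
    linarith
  have hbern : 1 + i * x ≤ (1 + x) ^ i := one_add_mul_le_pow (by linarith) i
  have hA : ((k + s + 1 + i + 1 : ℕ) : ℝ) * ((k + s + 1 + i).choose s : ℝ) =
      ((k + s + 1 + i + 1).choose (s + 1) : ℝ) * (s + 1) := by
    exact_mod_cast Nat.add_one_mul_choose_eq (k + s + 1 + i) s
  push_cast at hA
  have hpos : (0 : ℝ) < s + 1 := by positivity
  refine le_of_mul_le_mul_right ?_ hpos
  calc (1 + i * x) * (k + 1) * ((k + s + 1 + i + 1).choose (s + 1) : ℝ) * (s + 1)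
      = (1 + i * x) * (k + 1) * ((k + s + 1 + i).choose s : ℝ) * (k + s + 1 + i + 1) := by
        rw [mul_assoc, ← hA]; ring
    _ ≤ (1 + x) ^ i * (k + 1) * ((k + s + 1 + i).choose s : ℝ) * (k + s + 1 + i + 1) := by gcongr
    _ ≤ (s + 1) * ((k + s + 1 + i).choose k : ℝ) * (k + s + 1 + i + 1) := by gcongr
    _ = (k + s + 1 + i + 1) * ((k + s + 1 + i).choose k : ℝ) * (s + 1) := by ring

/-- The numerical comparison of binomial coefficients behind `cross_intersecting_bound`. -/
lemma mul_choose_lt_choose {C : ℝ} (hC : 2 < C) {n k₁ k₂ t : ℕ} (ht : t + 1 ≤ k₁)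
    (hk₁ : (n : ℝ) < C * k₁) (hk₂ : (n : ℝ) < C * k₂)
    (hD : 2 * (8 * C ^ 3 + 4 * C ^ 2 + 8) < (n : ℝ) - 2 * k₁)
    (habs : |(k₁ : ℝ) - k₂| ≤ C)
    (htD : (8 * C ^ 3 + 4 * C ^ 2 + 8) * k₁ ≤ 2 * (n - 2 * k₁) * (t : ℝ)) :
    C * ((n - t).choose (k₁ - t) : ℝ) < ((n - t - 1).choose k₂ : ℝ) := by
  obtain ⟨hab₁, hab₂⟩ := abs_le.1 habs
  set E : ℝ := 8 * C ^ 3 + 4 * C ^ 2 + 8 with hE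
  have hCsq : 2 * C < C ^ 2 := by nlinarith
  have hCcube : 0 < C ^ 3 := by positivity
  set D : ℝ := (n : ℝ) - 2 * k₁ with hDdef
  have hk₁pos : (0 : ℝ) < k₁ := by exact_mod_cast (by omega : 0 < k₁)
  have hD0 : 0 < D := by linarith
  have ht0 : (0 : ℝ) ≤ t := by positivity
  have htC : 2 * C ≤ t := by
    have h₁ : E * k₁ ≤ 2 * C * t * k₁ := by nlinarith
    have h₂ : E ≤ 2 * C * t := le_of_mul_le_mul_right h₁ hk₁pos
    nlinarith
  have hsum : (k₁ : ℝ) + k₂ + 1 ≤ n := by nlinarith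
  have hsum' : k₁ + k₂ + 1 ≤ n := by exact_mod_cast hsum
  have hks : k₁ ≤ k₂ + t + 1 := by
    have : (k₁ : ℝ) ≤ k₂ + t + 1 := by linarith
    exact_mod_cast this
  obtain ⟨s, rfl⟩ := Nat.exists_eq_add_of_le ht
  obtain ⟨i, rfl⟩ := Nat.exists_eq_add_of_le hsum'
  have key := one_add_mul_choose_succ_le (show s ≤ k₂ by omega) i
  rw [show t + 1 + s + k₂ + 1 + i - t - 1 = k₂ + s + 1 + i by omega,
    show t + 1 + s + k₂ + 1 + i - t = k₂ + s + 1 + i + 1 by omega,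
    show t + 1 + s - t = s + 1 by omega]
  push_cast at *
  set A : ℝ := ((k₂ + s + 1 + i + 1).choose (s + 1) : ℝ)
  set B : ℝ := ((k₂ + s + 1 + i).choose k₂ : ℝ)
  have hA : 0 < A := by
    simp only [A]; exact_mod_cast Nat.choose_pos (by omega)
  have hi : D / 2 ≤ i := by nlinarith
  have hd : (t : ℝ) / 2 ≤ k₂ - s := by linarith
  have hgain : C ^ 2 ≤ i * (((k₂ : ℝ) - s) / (k₂ + i + 1)) := by
    rw [← mul_div_assoc, le_div_iff₀ (by positivity)]
    have h₁ : D / 2 * (t / 2) ≤ i * ((k₂ : ℝ) - s) := by gcongr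
    have h₂ : (k₂ : ℝ) + i + 1 ≤ C * (t + 1 + s) := by linarith
    have h₃ : C ^ 2 * ((k₂ : ℝ) + i + 1) ≤ C ^ 2 * (C * (t + 1 + s)) := by gcongr
    nlinarith
  have hpos : (0 : ℝ) < k₂ + s + 1 + i + 1 := by positivity
  refine lt_of_mul_lt_mul_left ?_ hpos.le
  refine lt_of_lt_of_le ?_ key
  have h₁ : (k₂ : ℝ) + s + 1 + i + 1 < C * (k₂ + 1) := by linarith
  calc ((k₂ : ℝ) + s + 1 + i + 1) * (C * A) < C * (k₂ + 1) * (C * A) := by gcongr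
    _ = C ^ 2 * (k₂ + 1) * A := by ring
    _ ≤ (1 + i * (((k₂ : ℝ) - s) / (k₂ + i + 1))) * (k₂ + 1) * A := by
      gcongr
      linarith

/-- The sequence `t ↦ C(n - t, k - t)` brackets any integer between `1` and its value at `t₀`. -/
lemma exists_choose_bracket {n k t₀ g : ℕ} (ht₀ : t₀ + 1 ≤ k) (hg : 0 < g)
    (h : g ≤ (n - t₀).choose (k - t₀)) :
    ∃ t, t₀ ≤ t ∧ t + 1 ≤ k ∧ (n - t - 1).choose (k - t - 1) ≤ g ∧
      g ≤ (n - t).choose (k - t) := by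
  obtain ⟨d, rfl⟩ := Nat.exists_eq_add_of_le ht₀
  induction d generalizing t₀ with
  | zero => exact ⟨t₀, le_rfl, by omega, by simpa using Nat.one_le_iff_ne_zero.2 hg.ne', h⟩
  | succ d ih =>
    by_cases hle : (n - t₀ - 1).choose (t₀ + 1 + (d + 1) - t₀ - 1) ≤ g
    · exact ⟨t₀, le_rfl, by omega, hle, h⟩
    · have heq : t₀ + 1 + (d + 1) = t₀ + 1 + 1 + d := by omega
      rw [heq] at hle ⊢
      obtain ⟨t, ht, ht'⟩ := ih (t₀ := t₀ + 1) (by omega) (by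
        rw [Nat.sub_sub, Nat.sub_sub] at hle
        exact (not_le.1 hle).le)
      exact ⟨t, by omega, ht'⟩

/-- The binary logarithm of `(n - k) / k` is at most `2 (n - 2 k) / k`. -/
lemma mul_le_of_div_logb_le {n k t E : ℝ} (hk : 0 < k) (hn : 2 * k < n) (ht : 0 ≤ t)
    (h : E / Real.logb 2 ((n - k) / k) ≤ t) : E * k ≤ 2 * (n - 2 * k) * t := by
  have hy : 1 < (n - k) / k := by rw [lt_div_iff₀ hk]; linarith
  have hL : 0 < Real.logb 2 ((n - k) / k) := Real.logb_pos (by norm_num) hy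
  have hlog2 : (1 : ℝ) / 2 < Real.log 2 := by linarith [Real.log_two_gt_d9]
  have hLle : Real.logb 2 ((n - k) / k) ≤ 2 * ((n - 2 * k) / k) := by
    rw [Real.logb, div_le_iff₀ (by linarith)]
    have h₁ := Real.log_le_sub_one_of_pos (show 0 < (n - k) / k by linarith)
    have h₂ : (n - k) / k - 1 = (n - 2 * k) / k := by field_simp; ring
    have h₃ : 0 < (n - 2 * k) / k := div_pos (by linarith) hk
    nlinarith
  rw [div_le_iff₀ hL] at h
  calc E * k ≤ t * (2 * ((n - 2 * k) / k)) * k := by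
        gcongr
        exact h.trans (by gcongr)
    _ = 2 * (n - 2 * k) * t := by field_simp

theorem cross_intersecting_bound :
    ∀ C₁ : ℝ, 0 < C₁ → ∃ C₂ : ℝ, 0 < C₂ ∧
      ∀ n k₁ k₂ t₀ : ℕ, 0 < n → 0 < k₁ → 0 < k₂ → 0 < t₀ →
      (n : ℝ) / C₁ < k₁ → (k₁ : ℝ) < (n : ℝ) / 2 - C₂ →
      (n : ℝ) / C₁ < k₂ → (k₂ : ℝ) < (n : ℝ) / 2 - C₂ →
      |(k₁ : ℝ) - (k₂ : ℝ)| ≤ C₁ →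
      (t₀ : ℝ) ≥ C₂ / Real.logb 2 (((n : ℝ) - k₁) / k₁) →
      ∀ G₁ G₂ : Finset (Finset (Fin n)),
      (∀ S ∈ G₁, S.card = k₁) → (∀ S ∈ G₂, S.card = k₂) →
      CrossIntersecting G₁ G₂ →
      G₁.card ≤ Nat.choose (n - t₀) (k₁ - t₀) →
      (G₂.card : ℝ) + C₁ * (G₁.card : ℝ) ≤ (Nat.choose n k₂ : ℝ) ∧
        ((G₂.card : ℝ) + C₁ * (G₁.card : ℝ) = (Nat.choose n k₂ : ℝ) → G₁ = ∅) := by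
  intro C hC
  refine ⟨8 * C ^ 3 + 4 * C ^ 2 + 8, by positivity, ?_⟩
  intro n k₁ k₂ t₀ hn hk₁pos hk₂pos ht₀ hk₁ hk₁' hk₂ hk₂' habs hlog G₁ G₂ h₁ h₂ hcross hcard
  rcases G₁.eq_empty_or_nonempty with rfl | hne
  · have hsized : (G₂ : Set (Finset (Fin n))).Sized k₂ := fun S hS => h₂ S hS
    have hle : G₂.card ≤ n.choose k₂ := by simpa using hsized.card_le
    refine ⟨?_, fun _ => rfl⟩
    simpa using hle
  suffices hlt : (G₂.card : ℝ) + C * G₁.card < n.choose k₂ from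
    ⟨hlt.le, fun h => absurd h hlt.ne⟩
  have hCpow : 0 < C ^ 3 ∧ 0 < C ^ 2 := ⟨by positivity, by positivity⟩
  have hk₁R : (0 : ℝ) < k₁ := by exact_mod_cast hk₁pos
  rw [div_lt_iff₀ hC, mul_comm] at hk₁ hk₂
  have hC2 : 2 < C := by
    have : 2 * (k₁ : ℝ) < C * k₁ := by linarith
    exact lt_of_mul_lt_mul_right this hk₁R.le
  have hk₁two : (2 : ℝ) ≤ k₁ := by nlinarith
  have hk₁two' : 2 ≤ k₁ := by exact_mod_cast hk₁two
  set E : ℝ := 8 * C ^ 3 + 4 * C ^ 2 + 8 with hE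
  have hEpos : 0 < E := by positivity
  obtain ⟨t₁, ht₁, ht₁D, hcard₁⟩ : ∃ t₁ : ℕ, t₁ + 1 ≤ k₁ ∧
      E * k₁ ≤ 2 * (n - 2 * k₁) * (t₁ : ℝ) ∧ G₁.card ≤ (n - t₁).choose (k₁ - t₁) := by
    rcases lt_or_ge t₀ k₁ with hlt | hge
    · exact ⟨t₀, hlt, mul_le_of_div_logb_le hk₁R (by linarith) (by positivity) hlog, hcard⟩
    · refine ⟨k₁ - 1, by omega, ?_, hcard.trans ?_⟩
      · rw [Nat.cast_sub (by omega)]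
        push_cast
        nlinarith
      · rw [Nat.sub_eq_zero_of_le hge, Nat.choose_zero_right]
        have : (k₁ : ℝ) ≤ n := by linarith
        have : k₁ ≤ n := by exact_mod_cast this
        exact Nat.choose_pos (by omega)
  obtain ⟨t, ht₁t, ht, hlow, hup⟩ := exists_choose_bracket ht₁ hne.card_pos hcard₁
  have htR : (t₁ : ℝ) ≤ t := by exact_mod_cast ht₁t
  have htD : E * k₁ ≤ 2 * (n - 2 * k₁) * (t : ℝ) :=
    ht₁D.trans (mul_le_mul_of_nonneg_left htR (by linarith))
  have hsum : k₁ + k₂ ≤ n := by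
    have : (k₁ : ℝ) + k₂ ≤ n := by linarith
    exact_mod_cast this
  have hkk : (G₂.card : ℝ) + (n - t - 1).choose k₂ ≤ n.choose k₂ := by
    exact_mod_cast hcross.card_add_choose_le h₁ h₂ hsum ht hlow
  have hnum := mul_choose_lt_choose hC2 ht (by linarith) (by linarith) (by linarith) habs htD
  have hupR : (G₁.card : ℝ) ≤ (n - t).choose (k₁ - t) := by exact_mod_cast hup
  have := mul_le_mul_of_nonneg_left hupR hC.le
  linarith
end

section
/- Let r, k, n be positive integers with r ≤ n and k ≤ n, let F₁, ..., F_r ⊆ {S ⊆ {1,...,n} : |S| = k}, and let F = F₁ ∪ ... ∪ F_r. Then |F| ≤ C(n,k) − C(n−r,k) + Σ_{j=1}^{r} ( |{S ∈ F_j : j ∉ S}| − |{T ⊆ {r+1,...,n} : |T| = k−1 and T ∪ {j} ∉ F_j}| ), where C(a,b) denotes the binomial coefficient 'a choose b'. -/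
open Finset

/-- The sets `insert j T` with `j < r`, `T` contained in `{x | r ≤ x}` and `T ∈ B j` are determined
by the pair `(j, T)`. -/
theorem card_biUnion_insert_castLE {r n : ℕ} (hrn : r ≤ n)
    (B : Fin r → Finset (Finset (Fin n))) (hB : ∀ j, ∀ T ∈ B j, ∀ x ∈ T, r ≤ (x : ℕ)) :
    (univ.biUnion fun j => (B j).image (insert (Fin.castLE hrn j))).card = ∑ j, (B j).card := by
  have notMem : ∀ i j, ∀ T ∈ B j, Fin.castLE hrn i ∉ T := fun i j T hT hi =>
    absurd (hB j T hT _ hi) (by simp)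
  rw [card_biUnion]
  · refine sum_congr rfl fun j _ => card_image_of_injOn fun T hT U hU h => ?_
    rw [← erase_insert (notMem j j T hT), ← erase_insert (notMem j j U hU)]
    exact congrArg (fun S => S.erase (Fin.castLE hrn j)) h
  · intro i _ j _ hij
    rw [Function.onFun, disjoint_left]
    intro S hi hj
    obtain ⟨T, -, rfl⟩ := mem_image.1 hi
    obtain ⟨U, hU, h⟩ := mem_image.1 hj
    have hmem : Fin.castLE hrn i ∈ insert (Fin.castLE hrn j) U := h ▸ mem_insert_self _ _
    rcases mem_insert.1 hmem with h' | h'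
    · exact hij (Fin.castLE_injective hrn h')
    · exact notMem i j U hU h'

/-- The inequality between cardinalities with all terms moved to the side where they are added. -/
theorem card_biUnion_add_sum_card_add_choose_le {r k n : ℕ} (hk : 0 < k) (hrn : r ≤ n)
    (Fs : Fin r → Finset (Finset (Fin n))) (hFs : ∀ i, ∀ S ∈ Fs i, S.card = k) :
    (univ.biUnion Fs).card +
        ∑ j : Fin r, (univ.filter (fun T : Finset (Fin n) =>
          (∀ x ∈ T, r ≤ (x : ℕ)) ∧ T.card = k - 1 ∧ insert (Fin.castLE hrn j) T ∉ Fs j)).card +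
        (n - r).choose k ≤
      n.choose k + ∑ j : Fin r, ((Fs j).filter (fun S => Fin.castLE hrn j ∉ S)).card := by
  set A : Fin r → Finset (Finset (Fin n)) :=
    fun j => (Fs j).filter (fun S => Fin.castLE hrn j ∉ S)
  set B : Fin r → Finset (Finset (Fin n)) := fun j => univ.filter (fun T : Finset (Fin n) =>
    (∀ x ∈ T, r ≤ (x : ℕ)) ∧ T.card = k - 1 ∧ insert (Fin.castLE hrn j) T ∉ Fs j)
  change _ + ∑ j, (B j).card + _ ≤ _ + ∑ j, (A j).card
  have hB : ∀ j T, T ∈ B j ↔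
      (∀ x ∈ T, r ≤ (x : ℕ)) ∧ T.card = k - 1 ∧ insert (Fin.castLE hrn j) T ∉ Fs j := by
    simp [B]
  have notMem : ∀ i j, ∀ T ∈ B j, Fin.castLE hrn i ∉ T := fun i j T hT hi =>
    absurd (((hB j T).1 hT).1 _ hi) (by simp)
  set G := univ.biUnion Fs \ univ.biUnion A
  set M := univ.biUnion fun j => (B j).image (insert (Fin.castLE hrn j))
  set P := powersetCard k (univ.filter fun x : Fin n => r ≤ (x : ℕ))
  have hG : ∀ S ∈ G, S.card = k ∧ (∃ j, Fin.castLE hrn j ∈ S) ∧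
      ∀ j, S ∈ Fs j → Fin.castLE hrn j ∈ S := by
    intro S hS
    simp only [G, A, mem_sdiff, mem_biUnion, mem_univ, true_and, mem_filter, not_exists, not_and,
      not_not] at hS
    obtain ⟨⟨j, hj⟩, h⟩ := hS
    exact ⟨hFs j S hj, ⟨j, h j hj⟩, h⟩
  have hM : ∀ S ∈ M, ∃ j, ∃ T ∈ B j, insert (Fin.castLE hrn j) T = S := by
    simp [M]
  have hP : ∀ S ∈ P, ∀ j, Fin.castLE hrn j ∉ S := fun S hS j hj =>
    absurd (mem_filter.1 ((mem_powersetCard.1 hS).1 hj)).2 (by simp)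
  have disjoint_G_M : Disjoint G M := by
    rw [disjoint_left]
    intro S hS hS'
    obtain ⟨j, T, hT, rfl⟩ := hM S hS'
    obtain ⟨i, -, hi⟩ := mem_biUnion.1 (mem_sdiff.1 hS).1
    rcases mem_insert.1 ((hG _ hS).2.2 i hi) with h | h
    · obtain rfl := Fin.castLE_injective hrn h
      exact ((hB i T).1 hT).2.2 hi
    · exact notMem i j T hT h
  have disjoint_GM_P : Disjoint (G ∪ M) P := by
    rw [disjoint_left]
    intro S hS hS'
    rcases mem_union.1 hS with h | h
    · obtain ⟨j, hj⟩ := (hG S h).2.1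
      exact hP S hS' j hj
    · obtain ⟨j, T, -, rfl⟩ := hM S h
      exact hP _ hS' j (mem_insert_self _ _)
  have hsub : G ∪ M ∪ P ⊆ powersetCard k univ := by
    intro S hS
    refine mem_powersetCard.2 ⟨subset_univ _, ?_⟩
    rcases mem_union.1 hS with h | h
    · rcases mem_union.1 h with h | h
      · exact (hG S h).1
      · obtain ⟨j, T, hT, rfl⟩ := hM S h
        rw [card_insert_of_notMem (notMem j j T hT), ((hB j T).1 hT).2.1, Nat.sub_add_cancel hk]
    · exact (mem_powersetCard.1 h).2
  have hcard := card_le_card hsub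
  have card_P : P.card = (n - r).choose k := by
    rw [card_powersetCard]
    have := Fin.card_filter_val_lt (n := n) (m := r)
    have := card_filter_add_card_filter_not (s := (univ : Finset (Fin n)))
      (fun x : Fin n => (x : ℕ) < r)
    simp only [not_lt, card_univ, Fintype.card_fin] at this
    congr 1
    omega
  have card_M : M.card = ∑ j, (B j).card :=
    card_biUnion_insert_castLE hrn B fun j T hT => ((hB j T).1 hT).1
  rw [card_union_of_disjoint disjoint_GM_P, card_union_of_disjoint disjoint_G_M, card_P, card_M,
    card_powersetCard, card_univ, Fintype.card_fin] at hcard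
  have card_F : (univ.biUnion Fs).card ≤ G.card + (univ.biUnion A).card :=
    card_le_card_sdiff_add_card
  have card_A : (univ.biUnion A).card ≤ ∑ j, (A j).card := card_biUnion_le
  omega

theorem union_indicator_inequality (r k n : ℕ) (hr : 0 < r) (hk : 0 < k)
    (hrn : r ≤ n) (hkn : k ≤ n)
    (Fs : Fin r → Finset (Finset (Fin n)))
    (hFs : ∀ i, ∀ S ∈ Fs i, S.card = k) :
    ((Finset.univ.biUnion Fs).card : ℝ) ≤
      (Nat.choose n k : ℝ) - (Nat.choose (n - r) k : ℝ) +
        ∑ j : Fin r,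
          ((((Fs j).filter (fun S => Fin.castLE hrn j ∉ S)).card : ℝ) -
            ((Finset.univ.filter (fun T : Finset (Fin n) =>
                (∀ x ∈ T, r ≤ (x : ℕ)) ∧ T.card = k - 1 ∧
                  insert (Fin.castLE hrn j) T ∉ Fs j)).card : ℝ)) := by
  have h := card_biUnion_add_sum_card_add_choose_le hk hrn Fs hFs
  rw [← Nat.cast_le (α := ℝ)] at h
  push_cast at h
  rw [sum_sub_distrib]
  linarith
end

section
/- Let r, n be positive integers, and let F ⊆ P({1,...,n}) be a union of at most r intersecting families of subsets of {1,...,n}. Then |F| ≤ 2^n − 2^{n−r}. -/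
open Finset

/-- A family of finite sets is intersecting if any two of its members have
nonempty intersection. -/
def Intersecting' {n : ℕ} (F : Finset (Finset (Fin n))) : Prop :=
  ∀ A ∈ F, ∀ B ∈ F, (A ∩ B).Nonempty

theorem union_of_intersecting_families_powerset_bound (r n : ℕ) (hr : 0 < r) (hn : 0 < n)
    (F : Finset (Finset (Fin n)))
    (hF : ∃ Fs : Fin r → Finset (Finset (Fin n)),
      (∀ i, Intersecting' (Fs i)) ∧ F = Finset.univ.biUnion Fs) :
    (F.card : ℝ) ≤ (2 : ℝ) ^ (n : ℤ) - (2 : ℝ) ^ ((n : ℤ) - (r : ℤ)) := by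
  obtain ⟨Fs, hFs, rfl⟩ := hF
  have : Nonempty (Fin n) := ⟨⟨0, hn⟩⟩
  have hcard := card_biUnion_le_of_intersecting univ Fs fun i _ A hA B hB hAB =>
    (hFs i A hA B hB).ne_empty (disjoint_iff_inter_eq_empty.mp hAB)
  rw [Fintype.card_fin, card_univ, Fintype.card_fin] at hcard
  have hsub : ((2 ^ n - 2 ^ (n - r) : ℕ) : ℝ) = 2 ^ n - 2 ^ (n - r) := by
    rw [Nat.cast_sub (Nat.pow_le_pow_right two_pos (Nat.sub_le n r))]
    push_cast
    rfl
  have hpow : (2 : ℝ) ^ ((n : ℤ) - (r : ℤ)) ≤ 2 ^ (n - r) := by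
    rw [← zpow_natCast (2 : ℝ) (n - r)]
    exact zpow_le_zpow_right₀ one_le_two (by omega)
  calc ((univ.biUnion Fs).card : ℝ) ≤ ((2 ^ n - 2 ^ (n - r) : ℕ) : ℝ) := by exact_mod_cast hcard
    _ = 2 ^ n - 2 ^ (n - r) := hsub
    _ ≤ 2 ^ (n : ℤ) - 2 ^ ((n : ℤ) - (r : ℤ)) := by
      rw [zpow_natCast]
      exact sub_le_sub_left hpow _
end
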